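/- Suppose j ≥ 3 and α = α_1⋯α_j and β = β_1⋯β_j are minimal overlapping permutations in S_j with α_1 = β_1 = 1, α_j = β_j, and inv(α) = inv(β). Then for all n ≥ 0, Σ_{σ∈S_n} x^{α-mch(σ)} q^{inv(σ)} = Σ_{σ∈S_n} x^{β-mch(σ)} q^{inv(σ)}, as polynomials in x and q. -/

import Mathlib

open scoped Classical

noncomputable section

namespace CWilf

/-- The number of descents of a permutation of `{0, …, n-1}` (0-based). -/
def des {n : ℕ} (σ : Equiv.Perm (Fin n)) : ℕ :=
  (Finset.univ.filter fun i : Fin n =>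
    ∃ h : (i : ℕ) + 1 < n, σ ⟨(i : ℕ) + 1, h⟩ < σ i).card

/-- The number of inversions of `σ`. -/
def inv {n : ℕ} (σ : Equiv.Perm (Fin n)) : ℕ :=
  (Finset.univ.filter fun q : Fin n × Fin n => q.1 < q.2 ∧ σ q.2 < σ q.1).card

/-- The number of coinversions of `σ`. -/
def coinv {n : ℕ} (σ : Equiv.Perm (Fin n)) : ℕ :=
  (Finset.univ.filter fun q : Fin n × Fin n => q.1 < q.2 ∧ σ q.1 < σ q.2).card

/-- The number of left-to-right minima of `σ`. -/
def LRmin {n : ℕ} (σ : Equiv.Perm (Fin n)) : ℕ :=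
  (Finset.univ.filter fun j : Fin n => ∀ i : Fin n, i < j → σ j < σ i).card

/-- There is a `τ`-match of `σ` starting at (0-based) position `i`, i.e.
`red(σ_i σ_{i+1} ⋯ σ_{i+j-1}) = τ`. -/
def MatchAt {j n : ℕ} (τ : Equiv.Perm (Fin j)) (σ : Equiv.Perm (Fin n)) (i : ℕ) : Prop :=
  ∃ h : i + j ≤ n, ∀ a b : Fin j,
    τ a < τ b ↔
      σ ⟨i + (a : ℕ), by have := a.isLt; omega⟩ < σ ⟨i + (b : ℕ), by have := b.isLt; omega⟩

/-- The number of `τ`-matches of `σ`. -/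
def mch {j n : ℕ} (τ : Equiv.Perm (Fin j)) (σ : Equiv.Perm (Fin n)) : ℕ :=
  ((Finset.range n).filter fun i => MatchAt τ σ i).card

/-- `τ` is minimal overlapping: the smallest `n` such that some `σ ∈ S_n` has
exactly two `τ`-matches is `2j - 1`. -/
def MinOverlapping {j : ℕ} (τ : Equiv.Perm (Fin j)) : Prop :=
  IsLeast {n : ℕ | ∃ σ : Equiv.Perm (Fin n), mch τ σ = 2} (2 * j - 1)

/-- `α` and `β` are mutually minimal overlapping. -/
def MutuallyMinOverlapping {j : ℕ} (α β : Equiv.Perm (Fin j)) : Prop :=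
  MinOverlapping α ∧ MinOverlapping β ∧
    IsLeast {n : ℕ | ∃ σ : Equiv.Perm (Fin n), 1 ≤ mch α σ ∧ 1 ≤ mch β σ} (2 * j - 1)

/-- The set of permutations of `S_n` with no `τ`-match. -/
def NM (n : ℕ) {j : ℕ} (τ : Equiv.Perm (Fin j)) : Finset (Equiv.Perm (Fin n)) :=
  Finset.univ.filter fun σ => mch τ σ = 0


/-- The embedding of `Fin j` as the block of positions `i, …, i + j - 1`. -/
def block {i j n : ℕ} (h : i + j ≤ n) : Fin j ↪ Fin n where
  toFun a := ⟨i + a, by have := a.isLt; omega⟩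
  inj' a b hab := by
    simp only [Fin.mk.injEq] at hab
    ext
    omega

theorem block_val {i j n : ℕ} (h : i + j ≤ n) (a : Fin j) : (block h a : ℕ) = i + a :=
  rfl

theorem block_lt_block {i j n : ℕ} (h : i + j ≤ n) {a b : Fin j} :
    block h a < block h b ↔ a < b := by
  simp only [Fin.lt_def, block_val, Nat.add_lt_add_iff_left]

theorem mem_range_block {i j n : ℕ} (h : i + j ≤ n) (p : Fin n) :
    p ∈ Set.range (block h) ↔ i ≤ (p : ℕ) ∧ (p : ℕ) < i + j := by
  constructor
  · rintro ⟨a, rfl⟩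
    have := a.isLt
    simp only [block_val]
    omega
  · rintro ⟨h1, h2⟩
    refine ⟨⟨p - i, by omega⟩, ?_⟩
    ext
    simp only [block_val]
    omega

theorem matchAt_iff {i j n : ℕ} (h : i + j ≤ n) (τ : Equiv.Perm (Fin j))
    (σ : Equiv.Perm (Fin n)) :
    MatchAt τ σ i ↔ ∀ a b : Fin j, τ a < τ b ↔ σ (block h a) < σ (block h b) :=
  ⟨fun ⟨_, H⟩ => H, fun H => ⟨h, H⟩⟩

/-- The permutation acting as `π` on the block of positions `i, …, i + j - 1`. -/
def blockPerm {i j n : ℕ} (h : i + j ≤ n) (π : Equiv.Perm (Fin j)) : Equiv.Perm (Fin n) :=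
  Equiv.Perm.viaEmbeddingHom (block h) π

theorem blockPerm_block {i j n : ℕ} (h : i + j ≤ n) (π : Equiv.Perm (Fin j)) (a : Fin j) :
    blockPerm h π (block h a) = block h (π a) :=
  Equiv.Perm.viaEmbedding_apply π (block h) a

theorem blockPerm_of_notMem {i j n : ℕ} (h : i + j ≤ n) (π : Equiv.Perm (Fin j)) {p : Fin n}
    (hp : p ∉ Set.range (block h)) : blockPerm h π p = p :=
  Equiv.Perm.viaEmbedding_apply_of_notMem π (block h) p hp

theorem blockPerm_mem_range {i j n : ℕ} (h : i + j ≤ n) (π : Equiv.Perm (Fin j)) (p : Fin n) :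
    blockPerm h π p ∈ Set.range (block h) ↔ p ∈ Set.range (block h) := by
  by_cases hp : p ∈ Set.range (block h)
  · obtain ⟨a, rfl⟩ := hp
    simp [blockPerm_block]
  · rw [blockPerm_of_notMem h π hp]

theorem blockPerm_mul_inv {i j n : ℕ} (h : i + j ≤ n) (α β : Equiv.Perm (Fin j)) :
    blockPerm h (α⁻¹ * β) * blockPerm h (β⁻¹ * α) = 1 := by
  rw [blockPerm, blockPerm, ← map_mul]
  simp [mul_assoc]

theorem matchAt_mul_blockPerm {i j n : ℕ} (h : i + j ≤ n) (α β : Equiv.Perm (Fin j))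
    (σ : Equiv.Perm (Fin n)) (hσ : MatchAt α σ i) :
    MatchAt β (σ * blockPerm h (α⁻¹ * β)) i := by
  rw [matchAt_iff h] at hσ ⊢
  intro a b
  simp only [Equiv.Perm.mul_apply, blockPerm_block, ← hσ, Equiv.Perm.inv_def,
    Equiv.apply_symm_apply]

theorem matchAt_mul_blockPerm_of_separated {i k j n : ℕ} (hj : 0 < j) (h : i + j ≤ n)
    (π : Equiv.Perm (Fin j)) (h0 : π ⟨0, hj⟩ = ⟨0, hj⟩)
    (h1 : π ⟨j - 1, by omega⟩ = ⟨j - 1, by omega⟩)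
    (hik : i + (j - 1) ≤ k ∨ k + (j - 1) ≤ i)
    (τ : Equiv.Perm (Fin j)) (σ : Equiv.Perm (Fin n)) (hσ : MatchAt τ σ k) :
    MatchAt τ (σ * blockPerm h π) k := by
  obtain ⟨hk, hσ⟩ := hσ
  have key : ∀ a : Fin j, blockPerm h π (block hk a) = block hk a := by
    intro a
    have ha := a.isLt
    by_cases hp : block hk a ∈ Set.range (block h)
    · have hp' := (mem_range_block h _).1 hp
      simp only [block_val] at hp'
      rcases hik with hik | hik
      · have : block hk a = block h ⟨j - 1, by omega⟩ := by
          ext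
          simp only [block_val]
          omega
        rw [this, blockPerm_block, h1]
      · have : block hk a = block h ⟨0, hj⟩ := by
          ext
          simp only [block_val]
          omega
        rw [this, blockPerm_block, h0]
    · exact blockPerm_of_notMem h π hp
  rw [matchAt_iff hk]
  intro a b
  rw [Equiv.Perm.mul_apply, Equiv.Perm.mul_apply, key, key]
  exact hσ a b

/-- The inversions of `σ` inside the block of an occurrence of `τ` are counted by `inv τ`. -/
theorem card_inversions_block {i j n : ℕ} (h : i + j ≤ n) (τ : Equiv.Perm (Fin j))
    (σ : Equiv.Perm (Fin n)) (hσ : MatchAt τ σ i) :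
    (Finset.univ.filter fun q : Fin n × Fin n => (q.1 < q.2 ∧ σ q.2 < σ q.1) ∧
      (q.1 ∈ Set.range (block h) ∧ q.2 ∈ Set.range (block h))).card = inv τ := by
  rw [matchAt_iff h] at hσ
  rw [inv, ← Finset.card_map ((block h).prodMap (block h))]
  congr 1
  ext ⟨p, q⟩
  simp only [Finset.mem_filter, Finset.mem_univ, true_and, Finset.mem_map, Prod.exists,
    Function.Embedding.prodMap, Function.Embedding.coeFn_mk, Prod.map_apply, Prod.mk.injEq]
  constructor
  · rintro ⟨⟨h1, h2⟩, ⟨a, rfl⟩, ⟨b, rfl⟩⟩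
    exact ⟨a, b, ⟨(block_lt_block h).1 h1, (hσ b a).2 h2⟩, rfl, rfl⟩
  · rintro ⟨a, b, ⟨h1, h2⟩, rfl, rfl⟩
    exact ⟨⟨(block_lt_block h).2 h1, (hσ b a).1 h2⟩, ⟨a, rfl⟩, ⟨b, rfl⟩⟩

theorem blockPerm_lt_blockPerm {i j n : ℕ} (h : i + j ≤ n) (π : Equiv.Perm (Fin j))
    {p q : Fin n} (hpq : ¬ (p ∈ Set.range (block h) ∧ q ∈ Set.range (block h))) :
    blockPerm h π p < blockPerm h π q ↔ p < q := by
  have hp := blockPerm_mem_range h π p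
  have hq := blockPerm_mem_range h π q
  by_cases h1 : p ∈ Set.range (block h)
  · have h2 : q ∉ Set.range (block h) := fun h2 => hpq ⟨h1, h2⟩
    rw [blockPerm_of_notMem h π h2]
    have h3 := hp.2 h1
    rw [mem_range_block] at h1 h2 h3
    simp only [Fin.lt_def]
    omega
  · rw [blockPerm_of_notMem h π h1]
    by_cases h2 : q ∈ Set.range (block h)
    · have h3 := hq.2 h2
      rw [mem_range_block] at h1 h2 h3
      simp only [Fin.lt_def]
      omega
    · rw [blockPerm_of_notMem h π h2]

theorem inv_mul_blockPerm {i j n : ℕ} (h : i + j ≤ n) (α β : Equiv.Perm (Fin j))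
    (hinv : inv α = inv β) (σ : Equiv.Perm (Fin n)) (hσ : MatchAt α σ i) :
    inv (σ * blockPerm h (α⁻¹ * β)) = inv σ := by
  have hσ' := matchAt_mul_blockPerm h α β σ hσ
  set ρ := blockPerm h (α⁻¹ * β) with hρ
  have split : ∀ τ : Equiv.Perm (Fin n), inv τ =
      (Finset.univ.filter fun q : Fin n × Fin n => (q.1 < q.2 ∧ τ q.2 < τ q.1) ∧
        (q.1 ∈ Set.range (block h) ∧ q.2 ∈ Set.range (block h))).card +
      (Finset.univ.filter fun q : Fin n × Fin n => (q.1 < q.2 ∧ τ q.2 < τ q.1) ∧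
        ¬ (q.1 ∈ Set.range (block h) ∧ q.2 ∈ Set.range (block h))).card := by
    intro τ
    rw [inv, ← Finset.card_filter_add_card_filter_not
      (fun q : Fin n × Fin n => q.1 ∈ Set.range (block h) ∧ q.2 ∈ Set.range (block h)),
      Finset.filter_filter, Finset.filter_filter]
  rw [split, split σ, card_inversions_block h β _ hσ', card_inversions_block h α σ hσ, hinv]
  congr 1
  refine Finset.card_equiv (ρ.prodCongr ρ) ?_
  rintro ⟨p, q⟩
  simp only [Finset.mem_filter, Finset.mem_univ, true_and, Equiv.prodCongr_apply, Prod.map_apply,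
    Equiv.Perm.mul_apply, hρ, blockPerm_mem_range]
  constructor
  · rintro ⟨⟨h1, h2⟩, h3⟩
    exact ⟨⟨(blockPerm_lt_blockPerm h _ h3).2 h1, h2⟩, h3⟩
  · rintro ⟨⟨h1, h2⟩, h3⟩
    exact ⟨⟨(blockPerm_lt_blockPerm h _ h3).1 h1, h2⟩, h3⟩

/-- Every injective word has a reduction. -/
theorem exists_reduction {m n : ℕ} (f : Fin m → Fin n) (hf : Function.Injective f) :
    ∃ ρ : Equiv.Perm (Fin m), ∀ a b, ρ a < ρ b ↔ f a < f b := by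
  have hmono : StrictMono (f ∘ Tuple.sort f) :=
    (Tuple.monotone_sort f).strictMono_of_injective (hf.comp (Tuple.sort f).injective)
  refine ⟨(Tuple.sort f)⁻¹, fun a b => ?_⟩
  rw [← hmono.lt_iff_lt]
  simp

/-- Occurrences of a minimal overlapping permutation share at most one position. -/
theorem MinOverlapping.separated {j : ℕ} (hj : 0 < j) {τ : Equiv.Perm (Fin j)}
    (hτ : MinOverlapping τ) {n : ℕ} (σ : Equiv.Perm (Fin n)) {i k : ℕ} (hik : i < k)
    (hi : MatchAt τ σ i) (hk : MatchAt τ σ k) : i + (j - 1) ≤ k := by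
  have hex : ∃ k, i < k ∧ MatchAt τ σ k := ⟨k, hik, hk⟩
  obtain ⟨h1, h2⟩ := Nat.find_spec hex
  have hmin : ∀ l, i < l → l < Nat.find hex → ¬ MatchAt τ σ l :=
    fun l hl hl' hm => Nat.find_min hex hl' ⟨hl, hm⟩
  have hle : Nat.find hex ≤ k := Nat.find_min' hex ⟨hik, hk⟩
  generalize Nat.find hex = l at h1 h2 hmin hle
  obtain ⟨d, rfl⟩ := Nat.exists_eq_add_of_lt h1
  have hn : i + (d + 1 + j) ≤ n := by
    obtain ⟨h, -⟩ := h2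
    omega
  obtain ⟨ρ, hρ⟩ := exists_reduction (fun t => σ (block hn t))
    (σ.injective.comp (block hn).injective)
  have hmatch : ∀ t, t ≤ d + 1 → (MatchAt τ ρ t ↔ MatchAt τ σ (i + t)) := by
    intro t ht
    have e1 : t + j ≤ d + 1 + j := by omega
    have e2 : i + t + j ≤ n := by omega
    rw [matchAt_iff e1, matchAt_iff e2]
    have : ∀ a : Fin j, block hn (block e1 a) = block e2 a := by
      intro a
      ext
      simp only [block_val]
      omega
    simp only [hρ, this]
  have hcard : mch τ ρ = 2 := by
    have : ((Finset.range (d + 1 + j)).filter fun t => MatchAt τ ρ t) = {0, d + 1} := by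
      ext t
      simp only [Finset.mem_filter, Finset.mem_range, Finset.mem_insert, Finset.mem_singleton]
      constructor
      · rintro ⟨-, ht⟩
        have htd : t ≤ d + 1 := by
          obtain ⟨h, -⟩ := ht
          omega
        by_contra hne
        exact hmin (i + t) (by omega) (by omega) ((hmatch t htd).1 ht)
      · rintro (rfl | rfl)
        · exact ⟨by omega, (hmatch 0 (by omega)).2 hi⟩
        · exact ⟨by omega, (hmatch (d + 1) le_rfl).2 h2⟩
    rw [mch, this, Finset.card_pair (by omega)]
  have := hτ.2 ⟨ρ, hcard⟩
  omega

theorem sum_matchAt_exchange {j : ℕ} (hj : 0 < j) (α β : Equiv.Perm (Fin j))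
    (h0 : α ⟨0, hj⟩ = β ⟨0, hj⟩) (h1 : α ⟨j - 1, by omega⟩ = β ⟨j - 1, by omega⟩)
    (hinv : inv α = inv β) {R : Type*} [CommSemiring R] (x : R) {n : ℕ}
    (i : ℕ) (S T : Finset ℕ)
    (hS : ∀ k ∈ S, i + (j - 1) ≤ k ∨ k + (j - 1) ≤ i)
    (hT : ∀ k ∈ T, i + (j - 1) ≤ k ∨ k + (j - 1) ≤ i) :
    (∑ σ : Equiv.Perm (Fin n) with MatchAt α σ i ∧
      (∀ k ∈ S, MatchAt α σ k) ∧ ∀ k ∈ T, MatchAt β σ k, x ^ inv σ) =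
    ∑ σ : Equiv.Perm (Fin n) with MatchAt β σ i ∧
      (∀ k ∈ S, MatchAt α σ k) ∧ ∀ k ∈ T, MatchAt β σ k, x ^ inv σ := by
  by_cases h : i + j ≤ n
  · have fix : ∀ a, α a = β a → (α⁻¹ * β) a = a ∧ (β⁻¹ * α) a = a := by
      intro a ha
      constructor
      · rw [Equiv.Perm.mul_apply, ← ha, Equiv.Perm.inv_def, Equiv.symm_apply_apply]
      · rw [Equiv.Perm.mul_apply, ha, Equiv.Perm.inv_def, Equiv.symm_apply_apply]
    have keep : ∀ π : Equiv.Perm (Fin j), π ⟨0, hj⟩ = ⟨0, hj⟩ →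
        π ⟨j - 1, by omega⟩ = ⟨j - 1, by omega⟩ → ∀ σ : Equiv.Perm (Fin n),
        ((∀ k ∈ S, MatchAt α σ k) ∧ ∀ k ∈ T, MatchAt β σ k) →
        (∀ k ∈ S, MatchAt α (σ * blockPerm h π) k) ∧
          ∀ k ∈ T, MatchAt β (σ * blockPerm h π) k :=
      fun π e0 e1 σ hσ =>
        ⟨fun k hk => matchAt_mul_blockPerm_of_separated hj h π e0 e1 (hS k hk) α σ (hσ.1 k hk),
          fun k hk => matchAt_mul_blockPerm_of_separated hj h π e0 e1 (hT k hk) β σ (hσ.2 k hk)⟩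
    refine Finset.sum_nbij' (fun σ => σ * blockPerm h (α⁻¹ * β))
      (fun σ => σ * blockPerm h (β⁻¹ * α)) ?_ ?_ ?_ ?_ ?_
    · intro σ hσ
      simp only [Finset.mem_filter, Finset.mem_univ, true_and] at hσ ⊢
      exact ⟨matchAt_mul_blockPerm h α β σ hσ.1, keep _ (fix _ h0).1 (fix _ h1).1 σ hσ.2⟩
    · intro σ hσ
      simp only [Finset.mem_filter, Finset.mem_univ, true_and] at hσ ⊢
      exact ⟨matchAt_mul_blockPerm h β α σ hσ.1, keep _ (fix _ h0).2 (fix _ h1).2 σ hσ.2⟩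
    · intro σ _
      simp only [mul_assoc, blockPerm_mul_inv, mul_one]
    · intro σ _
      simp only [mul_assoc, blockPerm_mul_inv, mul_one]
    · intro σ hσ
      simp only [Finset.mem_filter, Finset.mem_univ, true_and] at hσ
      rw [inv_mul_blockPerm h α β hinv σ hσ.1]
  · have hno : ∀ (τ : Equiv.Perm (Fin j)) (σ : Equiv.Perm (Fin n)), ¬ MatchAt τ σ i :=
      fun _ _ hm => h hm.1
    simp [hno]

theorem sum_matchAt_eq_of_separated {j : ℕ} (hj : 0 < j) (α β : Equiv.Perm (Fin j))
    (h0 : α ⟨0, hj⟩ = β ⟨0, hj⟩) (h1 : α ⟨j - 1, by omega⟩ = β ⟨j - 1, by omega⟩)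
    (hinv : inv α = inv β) {R : Type*} [CommSemiring R] (x : R) {n : ℕ}
    (S T : Finset ℕ)
    (hST : ∀ k ∈ S ∪ T, ∀ l ∈ S ∪ T, k < l → k + (j - 1) ≤ l) (hdisj : Disjoint S T) :
    (∑ σ : Equiv.Perm (Fin n) with
      (∀ k ∈ S, MatchAt α σ k) ∧ ∀ k ∈ T, MatchAt β σ k, x ^ inv σ) =
    ∑ σ : Equiv.Perm (Fin n) with ∀ k ∈ S ∪ T, MatchAt β σ k, x ^ inv σ := by
  induction S using Finset.induction_on generalizing T with
  | empty => simp
  | insert i S hi ih =>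
    have hiT : i ∉ T := Finset.disjoint_left.1 hdisj (Finset.mem_insert_self i S)
    have hunion : S ∪ insert i T = insert i S ∪ T := by
      ext
      simp only [Finset.mem_union, Finset.mem_insert]
      tauto
    have hsep : ∀ k ∈ S ∪ T, i + (j - 1) ≤ k ∨ k + (j - 1) ≤ i := by
      intro k hk
      have hk' : k ∈ insert i S ∪ T := by
        rw [Finset.insert_union]
        exact Finset.mem_insert_of_mem hk
      have hi' : i ∈ insert i S ∪ T := by simp
      have hne : k ≠ i := by
        rintro rfl
        rcases Finset.mem_union.1 hk with hk | hk
        · exact hi hk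
        · exact hiT hk
      rcases lt_or_gt_of_ne hne with hlt | hlt
      · exact Or.inr (hST k hk' i hi' hlt)
      · exact Or.inl (hST i hi' k hk' hlt)
    have hex := sum_matchAt_exchange hj α β h0 h1 hinv x (n := n) i S T
      (fun k hk => hsep k (Finset.mem_union_left _ hk))
      (fun k hk => hsep k (Finset.mem_union_right _ hk))
    have := ih (insert i T) (by rwa [hunion]) (by
      rw [Finset.disjoint_insert_right]
      exact ⟨hi, hdisj.mono_left (Finset.subset_insert i S)⟩)
    rw [hunion] at this
    rw [← this]
    simp only [Finset.forall_mem_insert, and_assoc] at hex ⊢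
    rw [hex]
    simp only [and_left_comm]

theorem sum_forall_matchAt_eq {j : ℕ} (hj : 0 < j) (α β : Equiv.Perm (Fin j))
    (h0 : α ⟨0, hj⟩ = β ⟨0, hj⟩) (h1 : α ⟨j - 1, by omega⟩ = β ⟨j - 1, by omega⟩)
    (hinv : inv α = inv β) {R : Type*} [CommSemiring R] (x : R) {n : ℕ}
    (hα : MinOverlapping α) (hβ : MinOverlapping β) (S : Finset ℕ) :
    (∑ σ : Equiv.Perm (Fin n) with ∀ k ∈ S, MatchAt α σ k, x ^ inv σ) =
    ∑ σ : Equiv.Perm (Fin n) with ∀ k ∈ S, MatchAt β σ k, x ^ inv σ := by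
  by_cases hS : ∀ k ∈ S, ∀ l ∈ S, k < l → k + (j - 1) ≤ l
  · simpa using sum_matchAt_eq_of_separated hj α β h0 h1 hinv x (n := n) S ∅ (by simpa using hS)
      (Finset.disjoint_empty_right S)
  · push Not at hS
    obtain ⟨k, hk, l, hl, hkl, hlt⟩ := hS
    have hno : ∀ τ : Equiv.Perm (Fin j), MinOverlapping τ → ∀ σ : Equiv.Perm (Fin n),
        ¬ ∀ k ∈ S, MatchAt τ σ k := fun τ hτ σ hσ =>
      absurd (hτ.separated hj σ hkl (hσ k hk) (hσ l hl)) (by omega)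
    rw [Finset.filter_false_of_mem fun σ _ => hno α hα σ,
      Finset.filter_false_of_mem fun σ _ => hno β hβ σ]

/-- Inclusion–exclusion over sets of marked occurrences. -/
theorem sum_pow_mch_eq {R : Type*} [CommRing R] (x q : R) {j : ℕ} (τ : Equiv.Perm (Fin j))
    (n : ℕ) :
    (∑ σ : Equiv.Perm (Fin n), x ^ mch τ σ * q ^ inv σ) =
    ∑ S ∈ (Finset.range n).powerset, (x - 1) ^ S.card *
      ∑ σ : Equiv.Perm (Fin n) with ∀ k ∈ S, MatchAt τ σ k, q ^ inv σ := by
  have key : ∀ σ : Equiv.Perm (Fin n), x ^ mch τ σ =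
      ∑ S ∈ (Finset.range n).powerset,
        if ∀ k ∈ S, MatchAt τ σ k then (x - 1) ^ S.card else 0 := by
    intro σ
    rw [← Finset.sum_filter]
    have hpow : ((Finset.range n).powerset.filter fun S => ∀ k ∈ S, MatchAt τ σ k) =
        ((Finset.range n).filter fun i => MatchAt τ σ i).powerset := by
      ext S
      simp only [Finset.mem_filter, Finset.mem_powerset, Finset.subset_iff]
      exact ⟨fun H k hk => ⟨H.1 hk, H.2 k hk⟩, fun H => ⟨fun k hk => (H hk).1,
        fun k hk => (H hk).2⟩⟩
    rw [hpow, mch]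
    have := Finset.sum_pow_mul_eq_add_pow (x - 1) 1
      ((Finset.range n).filter fun i => MatchAt τ σ i)
    simpa using this.symm
  simp only [key, Finset.sum_mul, Finset.mul_sum, Finset.sum_filter]
  rw [Finset.sum_comm]
  refine Finset.sum_congr rfl fun S _ => Finset.sum_congr rfl fun σ _ => ?_
  split_ifs <;> simp

/-- Corollary: if `α, β ∈ S_j` (`j ≥ 3`) are minimal overlapping, both start with `1`,
end with the same element, and `inv α = inv β`, then for all `n ≥ 0`,
`Σ_{σ∈S_n} x^{α-mch σ} q^{inv σ} = Σ_{σ∈S_n} x^{β-mch σ} q^{inv σ}`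
as polynomials in `x` (= `X 0`) and `q` (= `X 1`). -/
theorem stmt3 {j : ℕ} (hj : 3 ≤ j) (α β : Equiv.Perm (Fin j))
    (hα : MinOverlapping α) (hβ : MinOverlapping β)
    (hα1 : α ⟨0, by omega⟩ = ⟨0, by omega⟩) (hβ1 : β ⟨0, by omega⟩ = ⟨0, by omega⟩)
    (hlast : α ⟨j - 1, by omega⟩ = β ⟨j - 1, by omega⟩)
    (hinv : inv α = inv β) :
    ∀ n : ℕ,
      (∑ σ : Equiv.Perm (Fin n),
        (MvPolynomial.X 0 : MvPolynomial (Fin 2) ℚ) ^ mch α σ * MvPolynomial.X 1 ^ inv σ) =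
      ∑ σ : Equiv.Perm (Fin n),
        (MvPolynomial.X 0 : MvPolynomial (Fin 2) ℚ) ^ mch β σ * MvPolynomial.X 1 ^ inv σ := by
  intro n
  rw [sum_pow_mch_eq, sum_pow_mch_eq]
  refine Finset.sum_congr rfl fun S _ => ?_
  rw [sum_forall_matchAt_eq (by omega) α β (hα1.trans hβ1.symm) hlast hinv _ hα hβ S]

end CWilf
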